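/- arXiv:2306.01854 — 10 statements merged into one kernel-verified Lean document; each statement's English description precedes it below -/
import Mathlib

section
/- Let τ ≥ 1 be an integer, let (r_t)_{t≥0} and (β_t)_{t≥1} be sequences of non-negative real numbers, and suppose that for every integer t ≥ 1 one has r_t ≤ (1 - 2/(t+τ))·r_{t-1} + β_t. Then for every integer T ≥ 1, r_T ≤ τ²·r_0/(T+τ)² + (∑_{t=1}^{T} β_t·(t+τ)²)/(T+τ)². -/
/-- Technical recursion lemma (Lemma for solving a recursion).
If `r t ≤ (1 - 2/(t+τ)) * r (t-1) + β t` for all `t ≥ 1`, then for all `T ≥ 1`,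
`r T ≤ τ² r 0 / (T+τ)² + (∑_{t=1}^T β t (t+τ)²) / (T+τ)²`. -/
theorem stmt_0 (τ : ℕ) (hτ : 1 ≤ τ) (r β : ℕ → ℝ)
    (hr : ∀ t, 0 ≤ r t) (hβ : ∀ t, 0 ≤ β t)
    (hrec : ∀ t : ℕ, 1 ≤ t →
      r t ≤ (1 - 2 / ((t : ℝ) + (τ : ℝ))) * r (t - 1) + β t) :
    ∀ T : ℕ, 1 ≤ T →
      r T ≤ (τ : ℝ) ^ 2 * r 0 / ((T : ℝ) + (τ : ℝ)) ^ 2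
        + (∑ t ∈ Finset.Icc 1 T, β t * ((t : ℝ) + (τ : ℝ)) ^ 2)
            / ((T : ℝ) + (τ : ℝ)) ^ 2 := by
  have key : ∀ T : ℕ, r T * ((T : ℝ) + (τ : ℝ)) ^ 2 ≤ (τ : ℝ) ^ 2 * r 0
      + ∑ t ∈ Finset.Icc 1 T, β t * ((t : ℝ) + (τ : ℝ)) ^ 2 := by
    intro T
    induction T with
    | zero => simp [mul_comm]
    | succ n ih =>
      rw [Finset.sum_Icc_succ_top (by omega)]
      have h := hrec (n + 1) (by omega)
      rw [Nat.add_sub_cancel] at h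
      have hpos : (0 : ℝ) < ((n + 1 : ℕ) : ℝ) + (τ : ℝ) := by positivity
      have hmul := mul_le_mul_of_nonneg_right h (sq_nonneg (((n + 1 : ℕ) : ℝ) + (τ : ℝ)))
      have hexpand : ((1 - 2 / (((n + 1 : ℕ) : ℝ) + (τ : ℝ))) * r n + β (n + 1))
            * (((n + 1 : ℕ) : ℝ) + (τ : ℝ)) ^ 2
          = r n * ((n : ℝ) + (τ : ℝ)) ^ 2 - r n
            + β (n + 1) * (((n + 1 : ℕ) : ℝ) + (τ : ℝ)) ^ 2 := by
        field_simp
        push_cast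
        ring
      linarith [hr n]
  intro T hT
  rw [← add_div, le_div_iff₀ (by positivity)]
  exact key T
end

section
/- Let q ∈ [0,1] be a real number and define η_t = (2/(t+2))^q for every natural number t. Then for every natural number t, η_t·(1 - η_{t+1}) ≤ η_{t+1}. -/
/-- For `q ∈ [0,1]` and `η t = (2/(t+2))^q`, we have
`η t * (1 - η (t+1)) ≤ η (t+1)` for every natural number `t`. -/
theorem stmt_1 (q : ℝ) (hq0 : 0 ≤ q) (hq1 : q ≤ 1)
    (η : ℕ → ℝ) (hη : ∀ t : ℕ, η t = (2 / ((t : ℝ) + 2)) ^ q) :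
    ∀ t : ℕ, η t * (1 - η (t + 1)) ≤ η (t + 1) := by
  intro t
  rw [hη, hη]
  push_cast
  have ht : (0 : ℝ) ≤ t := Nat.cast_nonneg t
  set a : ℝ := 2 / ((t : ℝ) + 2) with ha
  set b : ℝ := 2 / ((t : ℝ) + 1 + 2) with hb
  have ha0 : 0 < a := by positivity
  have hb0 : 0 < b := by positivity
  have ha1 : a ≤ 1 := by
    rw [ha, div_le_one (by positivity)]
    linarith
  have hab : a = b * (1 + a / 2) := by
    rw [ha, hb]
    field_simp
    ring
  have hratio : (1 + a / 2) ^ q ≤ 1 + a ^ q := calc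
    (1 + a / 2) ^ q ≤ (1 + a / 2) ^ (1 : ℝ) :=
      Real.rpow_le_rpow_of_exponent_le (by linarith) hq1
    _ = 1 + a / 2 := Real.rpow_one _
    _ ≤ 1 + a ^ (1 : ℝ) := by
      rw [Real.rpow_one]
      linarith
    _ ≤ 1 + a ^ q := by
      gcongr 1 + ?_
      exact Real.rpow_le_rpow_of_exponent_ge ha0 ha1 hq1
  have hpow : a ^ q ≤ b ^ q * (1 + a ^ q) := calc
    a ^ q = (b * (1 + a / 2)) ^ q := congrArg (· ^ q) hab
    _ = b ^ q * (1 + a / 2) ^ q := Real.mul_rpow hb0.le (by positivity)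
    _ ≤ b ^ q * (1 + a ^ q) := by gcongr
  linarith
end

section
/- Let q ∈ [0,1] be a real number and define η_t = (2/(t+2))^q for every natural number t. Then for every integer T ≥ 1, the product ∏_{t=0}^{T-1} (1 - η_{t+1}) ≤ η_T. -/
/-- For `q ∈ [0,1]` and `η t = (2/(t+2))^q`, for every `T ≥ 1`,
`∏_{t=0}^{T-1} (1 - η (t+1)) ≤ η T`. -/
theorem stmt_2 (q : ℝ) (hq0 : 0 ≤ q) (hq1 : q ≤ 1)
    (η : ℕ → ℝ) (hη : ∀ t : ℕ, η t = (2 / ((t : ℝ) + 2)) ^ q) :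
    ∀ T : ℕ, 1 ≤ T → ∏ t ∈ Finset.range T, (1 - η (t + 1)) ≤ η T := by
  have hpos (t : ℕ) : 0 < η t := by rw [hη]; positivity
  have hle (t : ℕ) : η t ≤ 1 := by
    rw [hη]
    refine Real.rpow_le_one (by positivity) ?_ hq0
    rw [div_le_one (by positivity)]
    linarith [Nat.cast_nonneg (α := ℝ) t]
  have hinv (t : ℕ) : (η t)⁻¹ = (((t : ℝ) + 2) / 2) ^ q := by
    rw [hη, ← Real.inv_rpow (by positivity), inv_div]
  have hstep (t : ℕ) : (η (t + 1))⁻¹ ≤ (η t)⁻¹ + 1 := by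
    rw [hinv, hinv]
    have hsub := Real.rpow_add_le_add_rpow (a := ((t : ℝ) + 2) / 2) (b := 1 / 2)
      (by positivity) (by norm_num) hq0 hq1
    have hhalf : (1 / 2 : ℝ) ^ q ≤ 1 := Real.rpow_le_one (by norm_num) (by norm_num) hq0
    have heq : (((t + 1 : ℕ) : ℝ) + 2) / 2 = ((t : ℝ) + 2) / 2 + 1 / 2 := by push_cast; ring
    rw [heq]
    linarith
  rintro T -
  induction T with
  | zero => simp [hη]
  | succ t ih =>
    rw [Finset.prod_range_succ]
    refine (mul_le_mul_of_nonneg_right ih (sub_nonneg.2 (hle _))).trans ?_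
    have h := mul_le_mul_of_nonneg_left (hstep t) (mul_pos (hpos t) (hpos (t + 1))).le
    have h₀ := (hpos t).ne'
    have h₁ := (hpos (t + 1)).ne'
    rw [mul_inv_cancel_right₀ h₁, mul_add, mul_one, mul_comm (η t), mul_inv_cancel_right₀ h₀] at h
    linarith
end

section
/- Let q ∈ [0,1) and p ≥ 0 be real numbers, let β_0 > 0, and define η_t = (2/(t+2))^q and β_t = β_0·(2/(t+2))^p for every natural number t. Then there exists a constant C > 1 (depending only on p and q) such that for every integer T ≥ 1, ∑_{t=0}^{T-1} β_t·∏_{τ=t+1}^{T-1} (1 - η_τ) ≤ C·β_T·η_T^{-1}. -/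
open Filter Topology in
theorem eventually_mul_le_rpow (q p : ℝ) (hq1 : q < 1) :
    ∃ N : ℕ, ∀ t : ℕ, N ≤ t → p * (2 / ((t : ℝ) + 2)) ≤ (2 / ((t : ℝ) + 2)) ^ q := by
  have h1 : Tendsto (fun t : ℕ => (((t : ℝ) + 2) / 2) ^ (1 - q)) atTop atTop :=
    (tendsto_rpow_atTop (sub_pos.2 hq1)).comp
      ((tendsto_atTop_add_const_right _ 2 tendsto_natCast_atTop_atTop).atTop_div_const two_pos)
  obtain ⟨N, hN⟩ := eventually_atTop.1 (h1.eventually_ge_atTop p)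
  refine ⟨N, fun t ht => ?_⟩
  have hr : 0 < 2 / ((t : ℝ) + 2) := by positivity
  have h := hN t ht
  rw [← inv_div, Real.inv_rpow hr.le, ← Real.rpow_neg hr.le, neg_sub] at h
  calc p * (2 / ((t : ℝ) + 2))
      ≤ (2 / ((t : ℝ) + 2)) ^ (q - 1) * (2 / ((t : ℝ) + 2)) := by gcongr
    _ = (2 / ((t : ℝ) + 2)) ^ q := by rw [← Real.rpow_add_one hr.ne', sub_add_cancel]

theorem one_sub_div_le_div_add_one_rpow {p s x : ℝ} (hp : 0 ≤ p) (hs : s ≤ p) (hx : 0 < x) :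
    1 - p / x ≤ (x / (x + 1)) ^ s := by
  have h0 : 0 < x / (x + 1) := by positivity
  have h1 : x / (x + 1) ≤ 1 := (div_le_one (by positivity)).2 (by linarith)
  refine le_trans ?_ (Real.rpow_le_rpow_of_exponent_ge h0 h1 hs)
  have hlog := Real.one_sub_inv_le_log_of_pos h0
  have hinv : 1 - (x / (x + 1))⁻¹ = -(1 / x) := by field_simp; ring
  rw [hinv] at hlog
  rw [Real.rpow_def_of_pos h0]
  have hmul := mul_le_mul_of_nonneg_right hlog hp
  have hexp := Real.add_one_le_exp (Real.log (x / (x + 1)) * p)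
  have : p / x = 1 / x * p := by ring
  linarith

theorem sum_mul_prod_Ico_succ {R : Type*} [CommRing R] (a b : ℕ → R) (T : ℕ) :
    ∑ t ∈ Finset.range (T + 1), b t * ∏ τ ∈ Finset.Ico (t + 1) (T + 1), a τ
      = (∑ t ∈ Finset.range T, b t * ∏ τ ∈ Finset.Ico (t + 1) T, a τ) * a T + b T := by
  rw [Finset.sum_range_succ, Finset.Ico_self, Finset.prod_empty, mul_one, Finset.sum_mul]
  congr 1
  refine Finset.sum_congr rfl fun t ht => ?_
  rw [Finset.prod_Ico_succ_top (Finset.mem_range.1 ht), mul_assoc]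


/-- For `q ∈ [0,1)`, `p ≥ 0`, `η t = (2/(t+2))^q` and
`β t = β₀ (2/(t+2))^p` with `β₀ > 0`, there exists a constant `C > 1`
(depending only on `p` and `q`) such that for every `T ≥ 1`,
`∑_{t=0}^{T-1} β t ∏_{τ=t+1}^{T-1} (1 - η τ) ≤ C * β T * (η T)⁻¹`. -/
theorem stmt_3 (q p : ℝ) (hq0 : 0 ≤ q) (hq1 : q < 1) (hp : 0 ≤ p) :
    ∃ C : ℝ, 1 < C ∧
      ∀ β₀ : ℝ, 0 < β₀ →
        ∀ η β : ℕ → ℝ,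
          (∀ t : ℕ, η t = (2 / ((t : ℝ) + 2)) ^ q) →
          (∀ t : ℕ, β t = β₀ * (2 / ((t : ℝ) + 2)) ^ p) →
          ∀ T : ℕ, 1 ≤ T →
            ∑ t ∈ Finset.range T, β t * ∏ τ ∈ Finset.Ico (t + 1) T, (1 - η τ)
              ≤ C * β T * (η T)⁻¹ := by
  obtain ⟨N, hN⟩ := eventually_mul_le_rpow q p hq1
  have hrN : 0 < (2 / ((N : ℝ) + 2)) ^ p := by positivity
  have hC : 2 ≤ 2 + N / (2 / ((N : ℝ) + 2)) ^ p := le_add_of_nonneg_right (by positivity)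
  refine ⟨2 + N / (2 / ((N : ℝ) + 2)) ^ p, by linarith, ?_⟩
  intro β₀ hβ₀ η β hη hβ T hT
  have hCN : N ≤ (2 + N / (2 / ((N : ℝ) + 2)) ^ p) * (2 / ((N : ℝ) + 2)) ^ p := by
    rw [add_mul, div_mul_cancel₀ _ hrN.ne']
    linarith
  generalize 2 + N / (2 / ((N : ℝ) + 2)) ^ p = C at hC hCN ⊢
  have hr0 (t : ℕ) : 0 < 2 / ((t : ℝ) + 2) := by positivity
  have hr1 (t : ℕ) : 2 / ((t : ℝ) + 2) ≤ 1 :=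
    (div_le_one (by positivity)).2 (by linarith [Nat.cast_nonneg (α := ℝ) t])
  have hη0 (t : ℕ) : 0 < η t := by rw [hη]; exact Real.rpow_pos_of_pos (hr0 t) q
  have hη1 (t : ℕ) : η t ≤ 1 := by rw [hη]; exact Real.rpow_le_one (hr0 t).le (hr1 t) hq0
  have hβ1 (t : ℕ) : β t ≤ β₀ := by
    rw [hβ]
    exact mul_le_of_le_one_right hβ₀.le (Real.rpow_le_one (hr0 t).le (hr1 t) hp)
  have hf (t : ℕ) : β t * (η t)⁻¹ = β₀ * (2 / ((t : ℝ) + 2)) ^ (p - q) := by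
    rw [hη, hβ, Real.rpow_sub (hr0 t), mul_assoc, ← div_eq_mul_inv]
  obtain ⟨S, hS⟩ : ∃ S : ℕ → ℝ, ∀ T, S T =
      ∑ t ∈ Finset.range T, β t * ∏ τ ∈ Finset.Ico (t + 1) T, (1 - η τ) := ⟨_, fun _ => rfl⟩
  have hS_succ (t : ℕ) : S (t + 1) = S t * (1 - η t) + β t := by
    rw [hS, hS, sum_mul_prod_Ico_succ]
  rw [← hS, mul_assoc]
  clear hT
  have hS_le (t : ℕ) : 0 ≤ S t ∧ S t ≤ t * β₀ := by
    induction t with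
    | zero => simp [hS]
    | succ t ih =>
      have hβ0 : 0 ≤ β t := by rw [hβ]; positivity
      rw [hS_succ]
      push_cast
      constructor
      · have := mul_nonneg ih.1 (sub_nonneg.2 (hη1 t))
        linarith
      · have := mul_nonneg ih.1 (hη0 t).le
        linarith [hβ1 t]
  have h_small (t : ℕ) (ht : t ≤ N) : S t ≤ C * (β t * (η t)⁻¹) := by
    have htN : (t : ℝ) ≤ N := by exact_mod_cast ht
    have hpow : (2 / ((N : ℝ) + 2)) ^ p ≤ (2 / ((t : ℝ) + 2)) ^ (p - q) :=
      calc (2 / ((N : ℝ) + 2)) ^ p ≤ (2 / ((t : ℝ) + 2)) ^ p := by gcongr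
        _ ≤ (2 / ((t : ℝ) + 2)) ^ (p - q) :=
          Real.rpow_le_rpow_of_exponent_ge (hr0 t) (hr1 t) (by linarith)
    rw [hf]
    calc S t ≤ t * β₀ := (hS_le t).2
      _ ≤ N * β₀ := by gcongr
      _ ≤ (C * (2 / ((N : ℝ) + 2)) ^ p) * β₀ := by gcongr
      _ ≤ (C * (2 / ((t : ℝ) + 2)) ^ (p - q)) * β₀ := by gcongr
      _ = C * (β₀ * (2 / ((t : ℝ) + 2)) ^ (p - q)) := by ring
  have h_step (t : ℕ) (ht : N ≤ t) (ih : S t ≤ C * (β t * (η t)⁻¹)) :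
      S (t + 1) ≤ C * (β (t + 1) * (η (t + 1))⁻¹) := by
    obtain ⟨F, hF⟩ : ∃ F, F = β t * (η t)⁻¹ := ⟨_, rfl⟩
    have hF0 : 0 < F := by rw [hF, hf]; have := hr0 t; positivity
    have hβF : β t = η t * F := by rw [hF]; field_simp [(hη0 t).ne']
    have hratio : F * (((t : ℝ) + 2) / ((t : ℝ) + 2 + 1)) ^ (p - q)
        = β (t + 1) * (η (t + 1))⁻¹ := by
      rw [hF, hf, hf, mul_assoc, ← Real.mul_rpow (hr0 t).le (by positivity)]
      congr 2
      push_cast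
      field_simp
      ring
    have hbern : 1 - η t / 2 ≤ (((t : ℝ) + 2) / ((t : ℝ) + 2 + 1)) ^ (p - q) := by
      refine le_trans ?_ (one_sub_div_le_div_add_one_rpow hp (by linarith) (by positivity))
      have h := hN t ht
      rw [← hη] at h
      have : p * (2 / ((t : ℝ) + 2)) = 2 * (p / ((t : ℝ) + 2)) := by ring
      linarith
    rw [← hF] at ih
    rw [← hratio, hS_succ, hβF]
    have h1η : 0 ≤ 1 - η t := sub_nonneg.2 (hη1 t)
    have hηF : 0 ≤ η t * F := mul_nonneg (hη0 t).le hF0.le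
    calc S t * (1 - η t) + η t * F ≤ C * F * (1 - η t) + η t * F := by gcongr
      _ ≤ C * (F * (1 - η t / 2)) := by nlinarith
      _ ≤ _ := by gcongr
  rcases le_total T N with h | h
  · exact h_small T h
  · induction T, h using Nat.le_induction with
    | base => exact h_small N le_rfl
    | succ t ht ih => exact h_step t ht ih
end

section
/- Let q ∈ (0,1) and p ≥ 0 be real numbers, let β_0 > 0, and define η_t = (2/(t+2))^q and β_t = β_0·(2/(t+2))^p for every natural number t. Then there exists a constant C > 0 (depending only on p and q) such that every sequence (r_t)_{t≥0} of non-negative real numbers satisfying r_t ≤ (1 - η_t)·r_{t-1} + β_t for all integers t ≥ 1 also satisfies, for every integer T ≥ 1, r_T ≤ C·(η_T·r_0 + β_T·η_T^{-1}). -/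
open Filter

/-- If `y ≤ h / 2`, the contraction factor `1 - h` absorbs a growth factor `exp y`. -/
theorem one_sub_mul_exp_le {h y : ℝ} (hh : h ≤ 1) (hy0 : 0 ≤ y) (hy : y ≤ h / 2) :
    (1 - h) * Real.exp y ≤ 1 - h / 2 := by
  have h1 : (1 - y) * Real.exp y ≤ 1 := by
    have h2 := mul_le_mul_of_nonneg_right (Real.one_sub_le_exp_neg y) (Real.exp_pos y).le
    rwa [← Real.exp_add, neg_add_cancel, Real.exp_zero] at h2
  have h3 : 1 - h ≤ (1 - h / 2) * (1 - y) := by nlinarith [mul_nonneg hy0 (hy0.trans hy)]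
  calc (1 - h) * Real.exp y ≤ (1 - h / 2) * (1 - y) * Real.exp y :=
        mul_le_mul_of_nonneg_right h3 (Real.exp_pos y).le
    _ = (1 - h / 2) * ((1 - y) * Real.exp y) := by ring
    _ ≤ (1 - h / 2) * 1 := mul_le_mul_of_nonneg_left h1 (by linarith)
    _ = 1 - h / 2 := mul_one _

theorem two_div_nat_add_two_pos (t : ℕ) : (0 : ℝ) < 2 / ((t : ℝ) + 2) := by positivity

theorem two_div_nat_add_two_le_one (t : ℕ) : 2 / ((t : ℝ) + 2) ≤ 1 := by
  rw [div_le_one (by positivity)]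
  linarith [(Nat.cast_nonneg t : (0 : ℝ) ≤ t)]

/-- For `q < 1`, the stepsize `(2 / (t + 2)) ^ q` eventually dominates any multiple of `1 / t`. -/
theorem eventually_div_le_stepsize {q : ℝ} (hq0 : 0 < q) (hq1 : q < 1) (m : ℝ) :
    ∀ᶠ t : ℕ in atTop, m / ((t : ℝ) + 2) ≤ (2 / (((t + 1 : ℕ) : ℝ) + 2)) ^ q / 2 := by
  have hlim : Tendsto (fun t : ℕ => ((t : ℝ) + 2) ^ (1 - q)) atTop atTop :=
    (tendsto_rpow_atTop (by linarith)).comp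
      (tendsto_atTop_add_const_right _ _ tendsto_natCast_atTop_atTop)
  filter_upwards [hlim.eventually_ge_atTop (2 * m)] with t ht
  have hpos : (0 : ℝ) < (t : ℝ) + 2 := by positivity
  have h1 : ((t : ℝ) + 2)⁻¹ ^ q ≤ (2 / (((t + 1 : ℕ) : ℝ) + 2)) ^ q := by
    refine Real.rpow_le_rpow (by positivity) ?_ hq0.le
    rw [inv_eq_one_div, div_le_div_iff₀ hpos (by positivity)]
    push_cast
    linarith [(Nat.cast_nonneg t : (0 : ℝ) ≤ t)]
  have h2 : ((t : ℝ) + 2)⁻¹ ^ q = ((t : ℝ) + 2) ^ (1 - q) / ((t : ℝ) + 2) := by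
    rw [Real.rpow_sub hpos, Real.rpow_one, Real.inv_rpow hpos.le]
    field_simp
  have h3 : 2 * m / ((t : ℝ) + 2) ≤ ((t : ℝ) + 2) ^ (1 - q) / ((t : ℝ) + 2) := by gcongr
  rw [mul_div_assoc] at h3
  linarith

/-- Consecutive powers of `2 / (t + 2)` grow by at most the factor `exp (m / (t + 2))`. -/
theorem two_div_rpow_le_exp_mul {s m : ℝ} (hsm : s ≤ m) (hm : 0 ≤ m) (t : ℕ) :
    (2 / ((t : ℝ) + 2)) ^ s ≤
      Real.exp (m / ((t : ℝ) + 2)) * (2 / (((t + 1 : ℕ) : ℝ) + 2)) ^ s := by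
  have hpos : (0 : ℝ) < (t : ℝ) + 2 := by positivity
  have hfac : 2 / ((t : ℝ) + 2) = (1 + 1 / ((t : ℝ) + 2)) * (2 / (((t + 1 : ℕ) : ℝ) + 2)) := by
    have : (t : ℝ) + 1 + 2 ≠ 0 := by positivity
    push_cast
    field_simp
    ring
  have hone : 1 ≤ 1 + 1 / ((t : ℝ) + 2) := by
    have : 0 ≤ 1 / ((t : ℝ) + 2) := by positivity
    linarith
  rw [hfac, Real.mul_rpow (by positivity) (by positivity)]
  refine mul_le_mul_of_nonneg_right ?_ (by positivity)
  calc (1 + 1 / ((t : ℝ) + 2)) ^ s ≤ (1 + 1 / ((t : ℝ) + 2)) ^ m :=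
        Real.rpow_le_rpow_of_exponent_le hone hsm
    _ ≤ Real.exp (1 / ((t : ℝ) + 2)) ^ m := by
        refine Real.rpow_le_rpow (by positivity) ?_ hm
        linarith [Real.add_one_le_exp (1 / ((t : ℝ) + 2))]
    _ = Real.exp (m / ((t : ℝ) + 2)) := by
        rw [← Real.exp_mul]
        congr 1
        ring

/-- A comparison principle: a recursion with contraction factor `1 - h t` and perturbation
`b * (h t * u t)` is dominated by `C * (a * h t + b * u t)` once `h` and `u` vary slowly. -/
theorem le_of_contraction_recursion {h u r : ℕ → ℝ} {a b C : ℝ} {N : ℕ}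
    (ha : 0 ≤ a) (hb : 0 ≤ b) (hC : 2 ≤ C)
    (hh0 : ∀ t, 0 ≤ h t) (hh1 : ∀ t, h t ≤ 1) (hu : ∀ t, 0 ≤ u t)
    (hhstep : ∀ t, N ≤ t → (1 - h (t + 1)) * h t ≤ (1 - h (t + 1) / 2) * h (t + 1))
    (hustep : ∀ t, N ≤ t → (1 - h (t + 1)) * u t ≤ (1 - h (t + 1) / 2) * u (t + 1))
    (hr : ∀ t, r (t + 1) ≤ (1 - h (t + 1)) * r t + b * (h (t + 1) * u (t + 1)))
    (hbase : ∀ t, t ≤ N → r t ≤ C * (a * h t + b * u t)) (t : ℕ) :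
    r t ≤ C * (a * h t + b * u t) := by
  induction t with
  | zero => exact hbase 0 (Nat.zero_le N)
  | succ t ih =>
    rcases Nat.lt_or_ge t N with htN | htN
    · exact hbase (t + 1) htN
    · have h1 := mul_le_mul_of_nonneg_left ih (sub_nonneg.2 (hh1 (t + 1)))
      have h2 := mul_le_mul_of_nonneg_left (hhstep t htN) (mul_nonneg (by linarith : 0 ≤ C) ha)
      have h3 := mul_le_mul_of_nonneg_left (hustep t htN) (mul_nonneg (by linarith : 0 ≤ C) hb)
      have h4 : 0 ≤ C * (a * (h (t + 1) * h (t + 1))) :=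
        mul_nonneg (by linarith) (mul_nonneg ha (mul_nonneg (hh0 _) (hh0 _)))
      have h5 : 0 ≤ (C - 2) * (b * (h (t + 1) * u (t + 1))) :=
        mul_nonneg (by linarith) (mul_nonneg hb (mul_nonneg (hh0 _) (hu _)))
      linarith [hr t]

/-- For `q ∈ (0,1)`, `p ≥ 0`, `η t = (2/(t+2))^q` and
`β t = β₀ (2/(t+2))^p` with `β₀ > 0`, there exists a constant `C > 0`
(depending only on `p` and `q`) such that every non-negative sequence `r`
satisfying `r t ≤ (1 - η t) r (t-1) + β t` for all `t ≥ 1` also satisfies,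
for every `T ≥ 1`, `r T ≤ C (η T * r 0 + β T * (η T)⁻¹)`. -/
theorem stmt_4 (q p : ℝ) (hq0 : 0 < q) (hq1 : q < 1) (hp : 0 ≤ p) :
    ∃ C : ℝ, 0 < C ∧
      ∀ β₀ : ℝ, 0 < β₀ →
        ∀ η β : ℕ → ℝ,
          (∀ t : ℕ, η t = (2 / ((t : ℝ) + 2)) ^ q) →
          (∀ t : ℕ, β t = β₀ * (2 / ((t : ℝ) + 2)) ^ p) →
          ∀ r : ℕ → ℝ, (∀ t, 0 ≤ r t) →
            (∀ t : ℕ, 1 ≤ t → r t ≤ (1 - η t) * r (t - 1) + β t) →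
            ∀ T : ℕ, 1 ≤ T → r T ≤ C * (η T * r 0 + β T * (η T)⁻¹) := by
  have hm : 0 ≤ p + q := by linarith
  obtain ⟨N, hN⟩ := eventually_atTop.1 (eventually_div_le_stepsize hq0 hq1 (p + q))
  have hxN : 0 < (2 / ((N : ℝ) + 2)) ^ (p + q) :=
    Real.rpow_pos_of_pos (two_div_nat_add_two_pos N) _
  refine ⟨max 2 (((N : ℝ) + 1) / (2 / ((N : ℝ) + 2)) ^ (p + q)),
    lt_max_of_lt_left two_pos, ?_⟩
  intro β₀ hβ₀ η β hη hβ r hr hrec T _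
  have hη0 : ∀ t, 0 < η t := fun t => by
    rw [hη]; exact Real.rpow_pos_of_pos (two_div_nat_add_two_pos t) _
  have hη1 : ∀ t, η t ≤ 1 := fun t => by
    rw [hη]
    exact Real.rpow_le_one (two_div_nat_add_two_pos t).le (two_div_nat_add_two_le_one t) hq0.le
  have hβ1 : ∀ t, β t ≤ β₀ := fun t => by
    rw [hβ]
    exact mul_le_of_le_one_right hβ₀.le
      (Real.rpow_le_one (two_div_nat_add_two_pos t).le (two_div_nat_add_two_le_one t) hp)
  have hβη : ∀ t, β t * (η t)⁻¹ = β₀ * (2 / ((t : ℝ) + 2)) ^ (p - q) := fun t => by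
    rw [hβ, hη, Real.rpow_sub (two_div_nat_add_two_pos t)]
    ring
  have hβ' : ∀ t, β t = β₀ * (η t * (2 / ((t : ℝ) + 2)) ^ (p - q)) := fun t => by
    rw [hβ, hη, ← Real.rpow_add (two_div_nat_add_two_pos t), add_sub_cancel]
  have hstep : ∀ s, s ≤ p + q → ∀ t : ℕ, N ≤ t →
      (1 - η (t + 1)) * (2 / ((t : ℝ) + 2)) ^ s ≤
        (1 - η (t + 1) / 2) * (2 / (((t + 1 : ℕ) : ℝ) + 2)) ^ s := by
    intro s hs t ht
    have hy := hN t ht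
    rw [← hη (t + 1)] at hy
    calc (1 - η (t + 1)) * (2 / ((t : ℝ) + 2)) ^ s
        ≤ (1 - η (t + 1)) * (Real.exp ((p + q) / ((t : ℝ) + 2)) *
            (2 / (((t + 1 : ℕ) : ℝ) + 2)) ^ s) :=
          mul_le_mul_of_nonneg_left (two_div_rpow_le_exp_mul hs hm t)
            (sub_nonneg.2 (hη1 (t + 1)))
      _ = (1 - η (t + 1)) * Real.exp ((p + q) / ((t : ℝ) + 2)) *
            (2 / (((t + 1 : ℕ) : ℝ) + 2)) ^ s := by ring
      _ ≤ _ := mul_le_mul_of_nonneg_right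
          (one_sub_mul_exp_le (hη1 (t + 1)) (by positivity) hy) (by positivity)
  have hrec' : ∀ t, r (t + 1) ≤ (1 - η (t + 1)) * r t + β (t + 1) := fun t =>
    hrec (t + 1) (Nat.le_add_left 1 t)
  have hcrude : ∀ t : ℕ, r t ≤ r 0 + β₀ * t := by
    intro t
    induction t with
    | zero => simp
    | succ t ih =>
      push_cast
      linarith [hrec' t, hβ1 (t + 1), mul_nonneg (hη0 (t + 1)).le (hr t)]
  rw [hβη, mul_comm (η T)]
  refine le_of_contraction_recursion (h := η) (u := fun t : ℕ => (2 / ((t : ℝ) + 2)) ^ (p - q))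
    (N := N) (hr 0) hβ₀.le (le_max_left _ _) (fun t => (hη0 t).le) hη1
    (fun t => by positivity) ?_ (hstep (p - q) (by linarith)) ?_ ?_ T
  · intro t ht
    have := hstep q (by linarith) t ht
    rwa [← hη t, ← hη (t + 1)] at this
  · intro t
    rw [← hβ' (t + 1)]
    exact hrec' t
  · intro t ht
    have htN : (t : ℝ) ≤ N := Nat.cast_le.2 ht
    have hlow : ∀ s, s ≤ p + q →
        (2 / ((N : ℝ) + 2)) ^ (p + q) ≤ (2 / ((t : ℝ) + 2)) ^ s := fun s hs =>
      (Real.rpow_le_rpow (by positivity) (by gcongr) hm).trans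
        (Real.rpow_le_rpow_of_exponent_ge (two_div_nat_add_two_pos t)
          (two_div_nat_add_two_le_one t) hs)
    have hlowη := hlow q (by linarith)
    rw [← hη t] at hlowη
    have hlowu := hlow (p - q) (by linarith)
    have hr0 := hr 0
    calc r t ≤ r 0 + β₀ * t := hcrude t
      _ ≤ ((N : ℝ) + 1) * (r 0 + β₀) := by
          nlinarith [mul_nonneg (Nat.cast_nonneg N : (0 : ℝ) ≤ N) hr0,
            mul_le_mul_of_nonneg_left htN hβ₀.le]
      _ = ((N : ℝ) + 1) / (2 / ((N : ℝ) + 2)) ^ (p + q) *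
            (r 0 * (2 / ((N : ℝ) + 2)) ^ (p + q) + β₀ * (2 / ((N : ℝ) + 2)) ^ (p + q)) := by
          rw [← add_mul, mul_comm (r 0 + β₀), ← mul_assoc, div_mul_cancel₀ _ hxN.ne']
      _ ≤ _ := by
          refine mul_le_mul (le_max_right _ _) ?_ (by positivity) (by positivity)
          gcongr
end

section
/- Let A, B, R ≥ 0 be real numbers and let (r_t)_{t≥0} be a sequence of non-negative real numbers with r_0 ≤ R² and, for every integer t ≥ 1, r_t ≤ (1 - 2/(t+1))·r_{t-1} + A·(2/(t+1))² + B. Then for every integer T ≥ 1, √(r_T) ≤ 2R/(T+1) + 2·√A·(2/(T+1))·√T + √B·√T. -/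
/-- A bound for the recursion with stepsize `2 / (t + 1)`: the initial value is
forgotten after one step, since the first contraction factor vanishes. -/
theorem le_of_two_div_recursion {A B : ℝ} (hA : 0 ≤ A) (hB : 0 ≤ B) {r : ℕ → ℝ}
    (hrec : ∀ t : ℕ, 1 ≤ t →
      r t ≤ (1 - 2 / ((t : ℝ) + 1)) * r (t - 1) + A * (2 / ((t : ℝ) + 1)) ^ 2 + B)
    {T : ℕ} (hT : 1 ≤ T) : r T ≤ 4 * A / ((T : ℝ) + 1) + B * T := by
  induction T, hT using Nat.le_induction with
  | base =>
    have h := hrec 1 le_rfl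
    norm_num at h ⊢
    linarith
  | succ n hn ih =>
    have h := hrec (n + 1) (by omega)
    simp only [Nat.add_sub_cancel, Nat.cast_add, Nat.cast_one] at h ⊢
    have hn0 : (0 : ℝ) ≤ n := Nat.cast_nonneg n
    have hc : 1 - 2 / ((n : ℝ) + 1 + 1) = n / (n + 2) := by
      field_simp
      ring
    rw [hc] at h
    have hstep := mul_le_mul_of_nonneg_left ih (show (0 : ℝ) ≤ n / (n + 2) by positivity)
    have hgap : 4 * A / ((n : ℝ) + 1 + 1) + B * (n + 1)
        - (n / (n + 2) * (4 * A / (n + 1) + B * n) + A * (2 / ((n : ℝ) + 1 + 1)) ^ 2 + B)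
        = 4 * A / ((n + 1) * (n + 2) ^ 2) + 2 * B * n / (n + 2) := by
      field_simp
      ring
    have hpos : 0 ≤ 4 * A / (((n : ℝ) + 1) * (n + 2) ^ 2) + 2 * B * n / (n + 2) := by
      positivity
    linarith


/-- If `r 0 ≤ R²` and
`r t ≤ (1 - 2/(t+1)) r (t-1) + A (2/(t+1))² + B` for all `t ≥ 1`, then for
every `T ≥ 1`, `√(r T) ≤ 2R/(T+1) + 2√A (2/(T+1)) √T + √B √T`. -/
theorem stmt_6 (A B R : ℝ) (hA : 0 ≤ A) (hB : 0 ≤ B) (hR : 0 ≤ R)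
    (r : ℕ → ℝ) (hr : ∀ t, 0 ≤ r t) (hr0 : r 0 ≤ R ^ 2)
    (hrec : ∀ t : ℕ, 1 ≤ t →
      r t ≤ (1 - 2 / ((t : ℝ) + 1)) * r (t - 1) + A * (2 / ((t : ℝ) + 1)) ^ 2 + B) :
    ∀ T : ℕ, 1 ≤ T →
      Real.sqrt (r T) ≤ 2 * R / ((T : ℝ) + 1)
        + 2 * Real.sqrt A * (2 / ((T : ℝ) + 1)) * Real.sqrt T
        + Real.sqrt B * Real.sqrt T := by
  intro T hT
  have hbound := le_of_two_div_recursion hA hB hrec hT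
  have hT1 : (1 : ℝ) ≤ T := by exact_mod_cast hT
  set x := 2 * Real.sqrt A * (2 / ((T : ℝ) + 1)) * Real.sqrt T with hx
  set y := Real.sqrt B * Real.sqrt T with hy
  have hx0 : 0 ≤ x := by positivity
  have hy0 : 0 ≤ y := by positivity
  have hR0 : 0 ≤ 2 * R / ((T : ℝ) + 1) := by positivity
  have hx2 : x ^ 2 = 16 * A * T / ((T : ℝ) + 1) ^ 2 := by
    rw [hx, mul_pow, mul_pow, mul_pow, Real.sq_sqrt hA, Real.sq_sqrt (by positivity)]
    field_simp
    ring
  have hy2 : y ^ 2 = B * T := by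
    rw [hy, mul_pow, Real.sq_sqrt hB, Real.sq_sqrt (by positivity)]
  have hAx : 4 * A / ((T : ℝ) + 1) ≤ x ^ 2 := by
    rw [hx2, div_le_div_iff₀ (by positivity) (by positivity)]
    have h : 0 ≤ 4 * A * ((T : ℝ) + 1) * (3 * T - 1) :=
      mul_nonneg (by positivity) (by linarith)
    linarith
  have hxy : Real.sqrt (r T) ≤ x + y :=
    Real.sqrt_le_iff.mpr ⟨by positivity, by nlinarith [mul_nonneg hx0 hy0]⟩
  linarith
end

section
/- Let F : ℝ^d → ℝ be differentiable with L-Lipschitz gradient, let θ ∈ ℝ^d, let g ∈ ℝ^d satisfy ‖∇F(θ) − g‖ ≤ δ for some δ ≥ 0, let d ∈ ℝ^d be nonzero, set e = d − g, let α > 0, and set θ' = θ + α·d/‖d‖. Then F(θ') ≥ F(θ) + (α/3)·‖∇F(θ)‖ − 2α·‖e‖ − (4/3)·δ·α − (L/2)·α². -/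
open scoped RealInnerProductSpace

/-- The quadratic lower bound for a function with `L`-Lipschitz gradient. -/
theorem add_inner_gradient_sub_le_of_lipschitz_gradient {E : Type*} [NormedAddCommGroup E]
    [InnerProductSpace ℝ E] [CompleteSpace E] {F : E → ℝ} {L : ℝ}
    (hdiff : Differentiable ℝ F)
    (hLip : ∀ x y : E, ‖gradient F x - gradient F y‖ ≤ L * ‖x - y‖) (x v : E) :
    F x + ⟪gradient F x, v⟫ - L / 2 * ‖v‖ ^ 2 ≤ F (x + v) := by
  let h : ℝ → ℝ := fun t ↦ F (x + t • v) - t * ⟪gradient F x, v⟫ + L / 2 * ‖v‖ ^ 2 * t ^ 2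
  have hderiv (t : ℝ) : HasDerivAt h
      (⟪gradient F (x + t • v), v⟫ - ⟪gradient F x, v⟫ + L * ‖v‖ ^ 2 * t) t := by
    have hline : HasDerivAt (fun s : ℝ ↦ x + s • v) v t := by
      simpa using ((hasDerivAt_id t).smul_const v).const_add x
    have hF := (hdiff (x + t • v)).hasGradientAt.hasFDerivAt.comp_hasDerivAt t hline
    refine ((hF.sub ((hasDerivAt_id t).mul_const ⟪gradient F x, v⟫)).add
      ((hasDerivAt_pow 2 t).const_mul (L / 2 * ‖v‖ ^ 2))).congr_deriv ?_
    simp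
    ring
  have hmono : MonotoneOn h (Set.Ici 0) := by
    refine monotoneOn_of_hasDerivWithinAt_nonneg (convex_Ici 0)
      (fun t _ ↦ (hderiv t).continuousAt.continuousWithinAt)
      (fun t _ ↦ (hderiv t).hasDerivWithinAt) fun t ht ↦ ?_
    have ht : 0 ≤ t := interior_subset ht
    have hnorm : ‖gradient F (x + t • v) - gradient F x‖ ≤ L * (t * ‖v‖) := by
      simpa [norm_smul, abs_of_nonneg ht] using hLip (x + t • v) x
    have hinner := neg_le_of_abs_le
      (abs_real_inner_le_norm (gradient F (x + t • v) - gradient F x) v)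
    rw [inner_sub_left] at hinner
    have := mul_le_mul_of_nonneg_right hnorm (norm_nonneg v)
    linarith
  have := hmono (Set.mem_Ici.2 le_rfl) (Set.mem_Ici.2 zero_le_one) zero_le_one
  simp only [h, zero_smul, add_zero, one_smul] at this
  linarith

/-- A vector `d` is aligned with `G` up to twice the distance between them. -/
theorem norm_sub_two_mul_norm_sub_le_inner_normalize {E : Type*} [NormedAddCommGroup E]
    [InnerProductSpace ℝ E] (G : E) {d : E} (hd : d ≠ 0) :
    ‖G‖ - 2 * ‖G - d‖ ≤ ⟪G, ‖d‖⁻¹ • d⟫ := by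
  have hu : ‖‖d‖⁻¹ • d‖ = 1 := by
    rw [norm_smul, norm_inv, norm_norm, inv_mul_cancel₀ (norm_ne_zero_iff.2 hd)]
  have hdu : ⟪d, ‖d‖⁻¹ • d⟫ = ‖d‖ := by
    rw [inner_smul_right, real_inner_self_eq_norm_sq]
    field_simp
  have hinner := neg_le_of_abs_le (abs_real_inner_le_norm (G - d) (‖d‖⁻¹ • d))
  rw [inner_sub_left, hdu, hu, mul_one] at hinner
  linarith [norm_sub_norm_le G d]

/-- Ascent lemma for a normalized step. If `F` is differentiable
with `L`-Lipschitz gradient, `g` approximates `∇F(θ)` with error at most `δ`,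
`e = d - g`, and `θ' = θ + α d/‖d‖` with `α > 0`, then
`F(θ') ≥ F(θ) + (α/3)‖∇F(θ)‖ - 2α‖e‖ - (4/3)δα - (L/2)α²`. -/
theorem stmt_10 {n : ℕ} (F : EuclideanSpace ℝ (Fin n) → ℝ) (L : ℝ) (hL : 0 < L)
    (hdiff : Differentiable ℝ F)
    (hLip : ∀ x y : EuclideanSpace ℝ (Fin n),
      ‖gradient F x - gradient F y‖ ≤ L * ‖x - y‖)
    (θ g d e θ' : EuclideanSpace ℝ (Fin n)) (δ α : ℝ)
    (hδ : 0 ≤ δ) (hg : ‖gradient F θ - g‖ ≤ δ) (hdne : d ≠ 0)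
    (he : e = d - g) (hα : 0 < α) (hθ' : θ' = θ + α • (‖d‖⁻¹ • d)) :
    F θ' ≥ F θ + (α / 3) * ‖gradient F θ‖ - 2 * α * ‖e‖
      - (4 / 3) * δ * α - (L / 2) * α ^ 2 := by
  have hu : ‖‖d‖⁻¹ • d‖ = 1 := by
    rw [norm_smul, norm_inv, norm_norm, inv_mul_cancel₀ (norm_ne_zero_iff.2 hdne)]
  have hasc := add_inner_gradient_sub_le_of_lipschitz_gradient hdiff hLip θ (α • (‖d‖⁻¹ • d))
  rw [← hθ', inner_smul_right, norm_smul, hu, mul_one, Real.norm_of_nonneg hα.le] at hasc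
  have halign : ‖gradient F θ‖ / 3 - 2 * ‖e‖ - 4 / 3 * δ ≤ ⟪gradient F θ, ‖d‖⁻¹ • d⟫ := by
    rcases le_total δ ‖gradient F θ‖ with h | h
    · have hGd : ‖gradient F θ - d‖ ≤ δ + ‖e‖ := by
        have : gradient F θ - d = (gradient F θ - g) - e := by rw [he]; abel
        rw [this]
        exact (norm_sub_le _ _).trans (by gcongr)
      linarith [norm_sub_two_mul_norm_sub_le_inner_normalize (gradient F θ) hdne]
    · have hinner := neg_le_of_abs_le (abs_real_inner_le_norm (gradient F θ) (‖d‖⁻¹ • d))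
      rw [hu, mul_one] at hinner
      linarith [norm_nonneg e]
  have := mul_le_mul_of_nonneg_left halign hα.le
  linarith
end

section
/- Let S and A be nonempty finite sets, let l_ψ ≥ 0, and let ψ : S × A × ℝ^d → ℝ be such that for every (s,a) ∈ S × A the map θ ↦ ψ(s,a;θ) is l_ψ-Lipschitz. Define the softmax policy π_θ(a|s) = exp(ψ(s,a;θ)) / ∑_{a'∈A} exp(ψ(s,a';θ)). Then for all θ, θ' ∈ ℝ^d and all (s,a) ∈ S × A, π_{θ'}(a|s)/π_θ(a|s) ≤ exp(2·l_ψ·‖θ' − θ‖). -/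
/-- For the softmax policy with `l_ψ`-Lipschitz logits, the
ratio of policies at two parameters is bounded by `exp(2 l_ψ ‖θ' - θ‖)`. -/
theorem stmt_11 {S A : Type*} [Fintype S] [Fintype A] [Nonempty S] [Nonempty A]
    {d : ℕ} (lψ : ℝ) (hlψ : 0 ≤ lψ)
    (ψ : S → A → EuclideanSpace ℝ (Fin d) → ℝ)
    (hLip : ∀ (s : S) (a : A) (θ₁ θ₂ : EuclideanSpace ℝ (Fin d)),
      |ψ s a θ₁ - ψ s a θ₂| ≤ lψ * ‖θ₁ - θ₂‖)
    (pol : EuclideanSpace ℝ (Fin d) → S → A → ℝ)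
    (hpol : ∀ θ s a,
      pol θ s a = Real.exp (ψ s a θ) / ∑ a' : A, Real.exp (ψ s a' θ))
    (θ θ' : EuclideanSpace ℝ (Fin d)) (s : S) (a : A) :
    pol θ' s a / pol θ s a ≤ Real.exp (2 * lψ * ‖θ' - θ‖) := by
  have hpos : ∀ ϑ, 0 < ∑ a' : A, Real.exp (ψ s a' ϑ) := fun ϑ =>
    Finset.sum_pos (fun _ _ => Real.exp_pos _) Finset.univ_nonempty
  have hnum : Real.exp (ψ s a θ') ≤ Real.exp (lψ * ‖θ' - θ‖) * Real.exp (ψ s a θ) := by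
    rw [← Real.exp_add, Real.exp_le_exp]
    linarith [(abs_le.mp (hLip s a θ' θ)).2]
  have hden : ∑ a' : A, Real.exp (ψ s a' θ) ≤
      Real.exp (lψ * ‖θ' - θ‖) * ∑ a' : A, Real.exp (ψ s a' θ') := by
    rw [Finset.mul_sum]
    refine Finset.sum_le_sum fun b _ => ?_
    rw [← Real.exp_add, Real.exp_le_exp]
    linarith [(abs_le.mp (hLip s b θ' θ)).1]
  have hexp : Real.exp (2 * lψ * ‖θ' - θ‖) =
      Real.exp (lψ * ‖θ' - θ‖) * Real.exp (lψ * ‖θ' - θ‖) := by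
    rw [← Real.exp_add]
    ring_nf
  rw [hpol, hpol, div_div_div_eq,
    div_le_iff₀ (mul_pos (hpos θ') (Real.exp_pos _)), hexp]
  calc _ ≤ _ := mul_le_mul hnum hden (hpos θ).le (by positivity)
    _ = _ := by ring
end

section
/- Let S and A be nonempty finite sets, let l_ψ ≥ 0, and let ψ : S × A × ℝ^d → ℝ be such that for every (s,a) ∈ S × A the map θ ↦ ψ(s,a;θ) is l_ψ-Lipschitz. Define the softmax policy π_θ(a|s) = exp(ψ(s,a;θ)) / ∑_{a'∈A} exp(ψ(s,a';θ)). Let θ ∈ ℝ^d, let d ∈ ℝ^d be nonzero, let α > 0, and set θ' = θ + α·d/‖d‖. Then for every natural number H and every sequence of state-action pairs (s_0,a_0), …, (s_{H-1},a_{H-1}) in S × A, the importance sampling weight ∏_{h=0}^{H-1} π_{θ'}(a_h|s_h)/π_θ(a_h|s_h) ≤ exp(2·H·l_ψ·α). -/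
/-- If two logit vectors differ by at most `c` in every coordinate, then the ratio of the
corresponding softmax probabilities is at most `exp (2 * c)`. -/
theorem softmax_div_softmax_le {A : Type*} [Fintype A] {f g : A → ℝ} {c : ℝ}
    (h : ∀ a, |f a - g a| ≤ c) (a : A) :
    (Real.exp (f a) / ∑ b, Real.exp (f b)) / (Real.exp (g a) / ∑ b, Real.exp (g b))
      ≤ Real.exp (2 * c) := by
  have : Nonempty A := ⟨a⟩
  have sum_pos (k : A → ℝ) : 0 < ∑ b, Real.exp (k b) :=
    Finset.sum_pos (fun b _ ↦ Real.exp_pos _) Finset.univ_nonempty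
  have hnum : Real.exp (f a) ≤ Real.exp c * Real.exp (g a) := by
    rw [← Real.exp_add, Real.exp_le_exp]
    linarith [(abs_le.mp (h a)).2]
  have hden : ∑ b, Real.exp (g b) ≤ Real.exp c * ∑ b, Real.exp (f b) := by
    rw [Finset.mul_sum]
    refine Finset.sum_le_sum fun b _ ↦ ?_
    rw [← Real.exp_add, Real.exp_le_exp]
    linarith [(abs_le.mp (h b)).1]
  rw [div_div_div_eq, div_le_iff₀ (mul_pos (sum_pos f) (Real.exp_pos _)), two_mul, Real.exp_add]
  calc Real.exp (f a) * ∑ b, Real.exp (g b)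
      ≤ (Real.exp c * Real.exp (g a)) * (Real.exp c * ∑ b, Real.exp (f b)) :=
        mul_le_mul hnum hden (sum_pos g).le (by positivity)
    _ = Real.exp c * Real.exp c * ((∑ b, Real.exp (f b)) * Real.exp (g a)) := by ring

/-- For the softmax policy with `l_ψ`-Lipschitz logits and a
normalized update `θ' = θ + α d/‖d‖`, the importance sampling weight of any
trajectory of length `H` is bounded by `exp(2 H l_ψ α)`. -/
theorem stmt_12 {S A : Type*} [Fintype S] [Fintype A] [Nonempty S] [Nonempty A]
    {dd : ℕ} (lψ : ℝ) (hlψ : 0 ≤ lψ)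
    (ψ : S → A → EuclideanSpace ℝ (Fin dd) → ℝ)
    (hLip : ∀ (s : S) (a : A) (θ₁ θ₂ : EuclideanSpace ℝ (Fin dd)),
      |ψ s a θ₁ - ψ s a θ₂| ≤ lψ * ‖θ₁ - θ₂‖)
    (pol : EuclideanSpace ℝ (Fin dd) → S → A → ℝ)
    (hpol : ∀ θ s a,
      pol θ s a = Real.exp (ψ s a θ) / ∑ a' : A, Real.exp (ψ s a' θ))
    (θ d θ' : EuclideanSpace ℝ (Fin dd)) (hdne : d ≠ 0)
    (α : ℝ) (hα : 0 < α) (hθ' : θ' = θ + α • (‖d‖⁻¹ • d))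
    (H : ℕ) (s : ℕ → S) (a : ℕ → A) :
    ∏ h ∈ Finset.range H, pol θ' (s h) (a h) / pol θ (s h) (a h)
      ≤ Real.exp (2 * (H : ℝ) * lψ * α) := by
  have hstep : ‖θ' - θ‖ = α := by
    rw [hθ', add_sub_cancel_left, norm_smul, norm_smul, norm_inv, norm_norm,
      inv_mul_cancel₀ (norm_ne_zero_iff.mpr hdne), mul_one, Real.norm_of_nonneg hα.le]
  have hratio (s : S) (a : A) : pol θ' s a / pol θ s a ≤ Real.exp (2 * (lψ * α)) := by
    rw [hpol, hpol]
    exact softmax_div_softmax_le (fun b ↦ hstep ▸ hLip s b θ' θ) a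
  have pol_nonneg (θ s a) : 0 ≤ pol θ s a := by
    rw [hpol]
    positivity
  calc ∏ h ∈ Finset.range H, pol θ' (s h) (a h) / pol θ (s h) (a h)
      ≤ ∏ _h ∈ Finset.range H, Real.exp (2 * (lψ * α)) :=
        Finset.prod_le_prod (fun _ _ ↦ div_nonneg (pol_nonneg _ _ _) (pol_nonneg _ _ _))
          fun h _ ↦ hratio (s h) (a h)
    _ = Real.exp (2 * (H : ℝ) * lψ * α) := by
        rw [Finset.prod_const, Finset.card_range, ← Real.exp_nat_mul]
        ring_nf
end

section
/- Let S and A be nonempty finite sets, let l_ψ ≥ 0, and let ψ : S × A × ℝ^d → ℝ be such that for every (s,a) ∈ S × A the map θ ↦ ψ(s,a;θ) is differentiable with gradient satisfying ‖∇_θ ψ(s,a;θ)‖ ≤ l_ψ for all θ ∈ ℝ^d. Define the softmax policy π_θ(a|s) = exp(ψ(s,a;θ)) / ∑_{a'∈A} exp(ψ(s,a';θ)). Then for every (s,a) ∈ S × A, the map θ ↦ log π_θ(a|s) is differentiable and ‖∇_θ log π_θ(a|s)‖ ≤ 2·l_ψ for all θ ∈ ℝ^d. -/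
theorem norm_gradient_eq_norm_fderiv {E : Type*} [NormedAddCommGroup E] [InnerProductSpace ℝ E]
    [CompleteSpace E] (f : E → ℝ) (x : E) : ‖gradient f x‖ = ‖fderiv ℝ f x‖ := by
  simp [gradient]

theorem hasFDerivAt_log_sum_exp {ι E : Type*} [Fintype ι] [Nonempty ι] [NormedAddCommGroup E]
    [NormedSpace ℝ E] {f : ι → E → ℝ} {f' : ι → E →L[ℝ] ℝ} {x : E}
    (hf : ∀ i, HasFDerivAt (f i) (f' i) x) :
    HasFDerivAt (fun y => Real.log (∑ i, Real.exp (f i y)))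
      ((∑ i, Real.exp (f i x))⁻¹ • ∑ i, Real.exp (f i x) • f' i) x := by
  have hpos : 0 < ∑ i, Real.exp (f i x) :=
    Finset.sum_pos (fun i _ => Real.exp_pos _) Finset.univ_nonempty
  exact (HasFDerivAt.fun_sum fun i _ => (hf i).exp).log hpos.ne'

/-- A convex combination with softmax weights of vectors of norm at most `C` has norm at most
`C`. -/
theorem norm_softmax_combination_le {ι F : Type*} [Fintype ι] [Nonempty ι]
    [NormedAddCommGroup F] [NormedSpace ℝ F] (w : ι → ℝ) (v : ι → F) {C : ℝ}
    (hv : ∀ i, ‖v i‖ ≤ C) :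
    ‖(∑ i, Real.exp (w i))⁻¹ • ∑ i, Real.exp (w i) • v i‖ ≤ C := by
  have hpos : 0 < ∑ i, Real.exp (w i) :=
    Finset.sum_pos (fun i _ => Real.exp_pos _) Finset.univ_nonempty
  rw [norm_smul, norm_inv, Real.norm_of_nonneg hpos.le, inv_mul_le_iff₀ hpos, Finset.sum_mul]
  refine norm_sum_le_of_le _ fun i _ => ?_
  rw [norm_smul, Real.norm_of_nonneg (Real.exp_pos _).le]
  exact mul_le_mul_of_nonneg_left (hv i) (Real.exp_pos _).le

/-- For the softmax policy whose logits `ψ s a` are differentiable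
with gradients bounded by `l_ψ`, the map `θ ↦ log π_θ(a|s)` is differentiable
and its gradient is bounded by `2 l_ψ`. -/
theorem stmt_13 {S A : Type*} [Fintype S] [Fintype A] [Nonempty S] [Nonempty A]
    {d : ℕ} (lψ : ℝ) (hlψ : 0 ≤ lψ)
    (ψ : S → A → EuclideanSpace ℝ (Fin d) → ℝ)
    (hdiff : ∀ (s : S) (a : A), Differentiable ℝ (ψ s a))
    (hgrad : ∀ (s : S) (a : A) (θ : EuclideanSpace ℝ (Fin d)),
      ‖gradient (ψ s a) θ‖ ≤ lψ)
    (pol : EuclideanSpace ℝ (Fin d) → S → A → ℝ)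
    (hpol : ∀ θ s a,
      pol θ s a = Real.exp (ψ s a θ) / ∑ a' : A, Real.exp (ψ s a' θ))
    (s : S) (a : A) :
    Differentiable ℝ (fun θ => Real.log (pol θ s a)) ∧
      ∀ θ : EuclideanSpace ℝ (Fin d),
        ‖gradient (fun θ => Real.log (pol θ s a)) θ‖ ≤ 2 * lψ := by
  have hlog : (fun θ => Real.log (pol θ s a)) =
      fun θ => ψ s a θ - Real.log (∑ a' : A, Real.exp (ψ s a' θ)) := by
    funext θ
    have hpos : 0 < ∑ a' : A, Real.exp (ψ s a' θ) :=
      Finset.sum_pos (fun i _ => Real.exp_pos _) Finset.univ_nonempty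
    rw [hpol, Real.log_div (Real.exp_pos _).ne' hpos.ne', Real.log_exp]
  have hderiv (θ : EuclideanSpace ℝ (Fin d)) :=
    (hdiff s a θ).hasFDerivAt.fun_sub
      (hasFDerivAt_log_sum_exp fun a' => (hdiff s a' θ).hasFDerivAt)
  rw [hlog]
  refine ⟨fun θ => (hderiv θ).differentiableAt, fun θ => ?_⟩
  have hbound (a' : A) : ‖fderiv ℝ (ψ s a') θ‖ ≤ lψ :=
    norm_gradient_eq_norm_fderiv (ψ s a') θ ▸ hgrad s a' θ
  rw [norm_gradient_eq_norm_fderiv, (hderiv θ).fderiv, two_mul]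
  exact norm_sub_le_of_le (hbound a) (norm_softmax_combination_le _ _ hbound)
end
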